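/- Let θ > 1 and K ≥ 0, and let Ξ assign to each pair 0 ≤ s ≤ t ≤ 1 a real number Ξ(s,t) such that |Ξ(s,t) − Ξ(s,u) − Ξ(u,t)| ≤ K (t−s)^θ whenever 0 ≤ s ≤ u ≤ t ≤ 1. Let 0 ≤ s ≤ t ≤ 1, let Δ be a partition of [s,t] with mesh at most δ > 0, and let Δ̂ ⊇ Δ be any refinement of Δ. Then, writing Ξ(Δ) := ∑ of Ξ over consecutive points of Δ, one has |Ξ(Δ̂) − Ξ(Δ)| ≤ 2^θ ζ(θ) K (t−s) δ^{θ−1}, where ζ(θ) = ∑_{n=1}^∞ n^{−θ}. -/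

import Mathlib

/-- The Riemann zeta sum `ζ(θ) = ∑_{n=1}^∞ n^{−θ}`. -/
noncomputable def zetaSum (θ : ℝ) : ℝ := ∑' n : ℕ, 1 / ((n : ℝ) + 1) ^ θ

/-- A finite sequence increasing at each step is monotone. -/
lemma le_of_forall_le_succ_below {v : ℕ → ℝ} {n : ℕ} (h : ∀ j, j < n → v j ≤ v (j + 1))
    {i j : ℕ} (hij : i ≤ j) (hj : j ≤ n) : v i ≤ v j := by
  induction j, hij using Nat.le_induction with
  | base => exact le_rfl
  | succ j _ ih => exact (ih (by omega)).trans (h j (by omega))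

/-- The effect on `∑ Ξ (v j) (v (j + 1))` of deleting the interior point `v (m + 1)`. -/
lemma sum_consecutive_sub_sum_delete (Ξ : ℝ → ℝ → ℝ) (v w : ℕ → ℝ) (m : ℕ)
    (hlo : ∀ j, j ≤ m → w j = v j) (hhi : ∀ j, m < j → w j = v (j + 1))
    {n : ℕ} (hmn : m ≤ n) :
    (∑ j ∈ Finset.range (n + 2), Ξ (v j) (v (j + 1)))
        - ∑ j ∈ Finset.range (n + 1), Ξ (w j) (w (j + 1))
      = Ξ (v m) (v (m + 1)) + Ξ (v (m + 1)) (v (m + 2)) - Ξ (v m) (v (m + 2)) := by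
  induction n, hmn using Nat.le_induction with
  | base =>
    have hsum : ∑ j ∈ Finset.range m, Ξ (w j) (w (j + 1))
        = ∑ j ∈ Finset.range m, Ξ (v j) (v (j + 1)) := by
      refine Finset.sum_congr rfl fun j hj => ?_
      have hj := Finset.mem_range.1 hj
      rw [hlo j (by omega), hlo (j + 1) (by omega)]
    rw [Finset.sum_range_succ, Finset.sum_range_succ, Finset.sum_range_succ, hsum,
      hlo m le_rfl, hhi (m + 1) (by omega)]
    ring
  | succ n hmn ih =>
    rw [Finset.sum_range_succ _ (n + 2),
      Finset.sum_range_succ (fun j => Ξ (w j) (w (j + 1))), hhi (n + 1) (by omega),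
      hhi (n + 1 + 1) (by omega)]
    linarith

/-- Some pair of neighbouring intervals has at most twice the average length. -/
lemma exists_short_double_interval (v : ℕ → ℝ) (n : ℕ)
    (hv : ∀ j, j < n + 2 → v j ≤ v (j + 1)) :
    ∃ m ≤ n, v (m + 2) - v m ≤ 2 * (v (n + 2) - v 0) / ((n : ℝ) + 1) := by
  have htel : ∑ m ∈ Finset.range (n + 1), (v (m + 2) - v m)
      = (v (n + 2) - v 1) + (v (n + 1) - v 0) := by
    rw [← Finset.sum_range_sub v (n + 1), ← Finset.sum_range_sub (fun j => v (j + 1)) (n + 1),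
      ← Finset.sum_add_distrib]
    exact Finset.sum_congr rfl fun j _ => by ring
  obtain ⟨m, hm, hle⟩ := Finset.exists_le_of_sum_le (s := Finset.range (n + 1))
    (f := fun m => v (m + 2) - v m)
    (g := fun _ => 2 * (v (n + 2) - v 0) / ((n : ℝ) + 1)) ⟨0, by simp⟩ (by
      rw [htel, Finset.sum_const, Finset.card_range, nsmul_eq_mul]
      push_cast
      rw [mul_div_cancel₀ _ (by positivity)]
      linarith [hv 0 (by omega), hv (n + 1) (by omega)])
  exact ⟨m, by have := Finset.mem_range.1 hm; omega, hle⟩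

/-- Young's point-removal estimate for a near-additive function. -/
lemma abs_sum_consecutive_sub_le {θ K : ℝ} (hθ : 0 ≤ θ) (hK : 0 ≤ K) {Ξ : ℝ → ℝ → ℝ}
    (hnear : ∀ s u t : ℝ, 0 ≤ s → s ≤ u → u ≤ t → t ≤ 1 →
      |Ξ s t - Ξ s u - Ξ u t| ≤ K * (t - s) ^ θ)
    (n : ℕ) (v : ℕ → ℝ) (hv0 : 0 ≤ v 0) (hv1 : v (n + 1) ≤ 1)
    (hv : ∀ j, j < n + 1 → v j ≤ v (j + 1)) :
    |(∑ j ∈ Finset.range (n + 1), Ξ (v j) (v (j + 1))) - Ξ (v 0) (v (n + 1))|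
      ≤ 2 ^ θ * (∑ k ∈ Finset.range n, 1 / ((k : ℝ) + 1) ^ θ) * K * (v (n + 1) - v 0) ^ θ := by
  induction n generalizing v with
  | zero => simp
  | succ n ih =>
    have hmono : ∀ i j, i ≤ j → j ≤ n + 2 → v i ≤ v j := fun i j =>
      le_of_forall_le_succ_below hv
    obtain ⟨m, hmn, hm⟩ := exists_short_double_interval v n hv
    set w : ℕ → ℝ := fun j => if j ≤ m then v j else v (j + 1) with hw
    have hlo : ∀ j, j ≤ m → w j = v j := fun j hj => by simp [hw, hj]
    have hhi : ∀ j, m < j → w j = v (j + 1) := fun j hj => by simp [hw, hj]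
    have hw0 : w 0 = v 0 := hlo 0 (Nat.zero_le m)
    have hwn : w (n + 1) = v (n + 2) := hhi (n + 1) (by omega)
    have hrec := ih w (by rwa [hw0]) (by rwa [hwn]) (fun j hj => by
      by_cases h : j + 1 ≤ m
      · rw [hlo j (by omega), hlo _ h]
        exact hmono _ _ (by omega) (by omega)
      · rw [hhi (j + 1) (by omega)]
        by_cases h' : j ≤ m
        · rw [hlo j h']
          exact hmono _ _ (by omega) (by omega)
        · rw [hhi j (by omega)]
          exact hmono _ _ (by omega) (by omega))
    rw [hw0, hwn] at hrec
    have hdel := sum_consecutive_sub_sum_delete Ξ v w m hlo hhi hmn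
    have hloc := hnear (v m) (v (m + 1)) (v (m + 2))
      (hv0.trans (hmono 0 m (by omega) (by omega))) (hmono _ _ (by omega) (by omega))
      (hmono _ _ (by omega) (by omega)) ((hmono _ _ (by omega) le_rfl).trans hv1)
    have hL : 0 ≤ v (n + 2) - v 0 := sub_nonneg.2 (hmono _ _ (by omega) le_rfl)
    have hpow : (v (m + 2) - v m) ^ θ
        ≤ 2 ^ θ * (v (n + 2) - v 0) ^ θ * (1 / ((n : ℝ) + 1) ^ θ) := by
      calc (v (m + 2) - v m) ^ θ ≤ (2 * (v (n + 2) - v 0) / ((n : ℝ) + 1)) ^ θ :=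
            Real.rpow_le_rpow (sub_nonneg.2 (hmono _ _ (by omega) (by omega))) hm hθ
        _ = _ := by
            rw [Real.div_rpow (by positivity) (by positivity),
              Real.mul_rpow (by norm_num) hL]
            ring
    have hstep := mul_le_mul_of_nonneg_left hpow hK
    rw [Finset.sum_range_succ (fun k : ℕ => 1 / ((k : ℝ) + 1) ^ θ)]
    rw [abs_le] at hrec hloc ⊢
    constructor <;> ring_nf at hrec hloc hdel hstep ⊢ <;> linarith [hrec.1, hrec.2, hloc.1, hloc.2]

/-- Partial sums of the zeta series are at most its value. -/
lemma sum_range_le_zetaSum {θ : ℝ} (hθ : 1 < θ) (n : ℕ) :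
    ∑ k ∈ Finset.range n, 1 / ((k : ℝ) + 1) ^ θ ≤ zetaSum θ := by
  have hsum : Summable fun k : ℕ => 1 / ((k : ℝ) + 1) ^ θ := by
    simpa using (summable_nat_add_iff 1).2 (Real.summable_one_div_nat_rpow.2 hθ)
  exact hsum.sum_le_tsum _ fun k _ => by positivity

/-- refinement estimate for a near-additive function: if
`|Ξ(s,t) − Ξ(s,u) − Ξ(u,t)| ≤ K (t−s)^θ` with `θ > 1`, `Δ` is a partition of `[s,t]` with
mesh at most `δ > 0` and `Δ̂ ⊇ Δ` is any refinement, then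
`|Ξ(Δ̂) − Ξ(Δ)| ≤ 2^θ ζ(θ) K (t−s) δ^{θ−1}`. -/
theorem near_additive_refinement_estimate (θ K δ : ℝ) (hθ : 1 < θ) (hK : 0 ≤ K) (hδ : 0 < δ)
    (Ξ : ℝ → ℝ → ℝ)
    (hnear : ∀ s u t : ℝ, 0 ≤ s → s ≤ u → u ≤ t → t ≤ 1 →
      |Ξ s t - Ξ s u - Ξ u t| ≤ K * (t - s) ^ θ)
    (s t : ℝ) (hs : 0 ≤ s) (hst : s ≤ t) (ht : t ≤ 1)
    -- the partition Δ, given by points u 0 < u 1 < ⋯ < u N, with mesh at most δ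
    (N : ℕ) (hN : 1 ≤ N) (u : ℕ → ℝ)
    (hu0 : u 0 = s) (huN : u N = t)
    (hmono : ∀ i, i < N → u i < u (i + 1))
    (hmesh : ∀ i, i < N → u (i + 1) - u i ≤ δ)
    -- the refinement Δ̂, given by points v 0 < v 1 < ⋯ < v N', containing all points of Δ
    (N' : ℕ) (hN' : 1 ≤ N') (v : ℕ → ℝ)
    (hv0 : v 0 = s) (hvN' : v N' = t)
    (hmono' : ∀ j, j < N' → v j < v (j + 1))
    (hrefine : ∀ i, i ≤ N → ∃ j, j ≤ N' ∧ v j = u i) :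
    |(∑ j ∈ Finset.range N', Ξ (v j) (v (j + 1)))
        - ∑ i ∈ Finset.range N, Ξ (u i) (u (i + 1))|
      ≤ 2 ^ θ * zetaSum θ * K * (t - s) * δ ^ (θ - 1) := by
  have hmv : ∀ i j, i ≤ j → j ≤ N' → v i ≤ v j := fun i j =>
    le_of_forall_le_succ_below fun j hj => (hmono' j hj).le
  have hlt : ∀ i j, i < j → j ≤ N' → v i < v j := fun i j hij hj =>
    (hmono' i (by omega)).trans_le (hmv _ _ hij hj)
  choose! J hJle hJ using hrefine
  have hJ0 : J 0 = 0 := by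
    by_contra h
    have := hlt 0 (J 0) (by omega) (hJle 0 (by omega))
    rw [hJ 0 (by omega), hu0, hv0] at this
    exact lt_irrefl _ this
  have hJN : J N = N' := by
    by_contra h
    have := hlt (J N) N' (lt_of_le_of_ne (hJle N le_rfl) h) le_rfl
    rw [hJ N le_rfl, huN, hvN'] at this
    exact lt_irrefl _ this
  have key : ∀ k, k ≤ N →
      |(∑ j ∈ Finset.range (J k), Ξ (v j) (v (j + 1)))
          - ∑ i ∈ Finset.range k, Ξ (u i) (u (i + 1))|
        ≤ 2 ^ θ * zetaSum θ * K * (u k - s) * δ ^ (θ - 1) := by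
    intro k
    induction k with
    | zero => simp [hJ0, hu0]
    | succ k ih =>
      intro hk
      have hrec := ih (by omega)
      have hJk := hJ k (by omega)
      have hJk' := hJ (k + 1) hk
      have hJle' := hJle (k + 1) hk
      have hJlt : J k < J (k + 1) := by
        by_contra h
        have := hmv _ _ (not_lt.1 h) (hJle k (by omega))
        rw [hJk, hJk'] at this
        exact absurd (hmono k (by omega)) (not_lt.2 this)
      obtain ⟨n, hn⟩ : ∃ n, J (k + 1) = J k + (n + 1) := ⟨J (k + 1) - J k - 1, by omega⟩
      have hend : v (J k + (n + 1)) = u (k + 1) := by rw [← hn, hJk']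
      have hpiece := abs_sum_consecutive_sub_le (by linarith) hK hnear n (fun j => v (J k + j))
        (by simpa [hv0] using hs.trans (hv0.symm.le.trans (hmv 0 (J k) (by omega) (by omega))))
        ((hmv _ _ (by omega) le_rfl).trans (hvN'.le.trans ht))
        (fun j hj => hmv _ _ (by omega) (by omega))
      simp only [add_zero, hend, hJk] at hpiece
      have hgap : 0 < u (k + 1) - u k := sub_pos.2 (hmono k (by omega))
      have hpow : (u (k + 1) - u k) ^ θ ≤ (u (k + 1) - u k) * δ ^ (θ - 1) := by
        have hsplit : (u (k + 1) - u k) ^ θ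
            = (u (k + 1) - u k) * (u (k + 1) - u k) ^ (θ - 1) := by
          rw [Real.rpow_sub_one hgap.ne', mul_div_cancel₀ _ hgap.ne']
        rw [hsplit]
        exact mul_le_mul_of_nonneg_left
          (Real.rpow_le_rpow hgap.le (hmesh k (by omega)) (by linarith)) hgap.le
      have hz := sum_range_le_zetaSum hθ n
      have hz0 : 0 ≤ zetaSum θ := by simpa using sum_range_le_zetaSum hθ 0
      have hbound : 2 ^ θ * (∑ k ∈ Finset.range n, 1 / ((k : ℝ) + 1) ^ θ) * K
            * (u (k + 1) - u k) ^ θ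
          ≤ 2 ^ θ * zetaSum θ * K * ((u (k + 1) - u k) * δ ^ (θ - 1)) := by
        gcongr
      rw [hn, Finset.sum_range_add, Finset.sum_range_succ (fun i => Ξ (u i) (u (i + 1)))]
      simp only [← add_assoc] at hpiece ⊢
      rw [abs_le] at hrec hpiece ⊢
      constructor <;> linarith [hrec.1, hrec.2, hpiece.1, hpiece.2]
  simpa [hJN, huN] using key N le_rfl
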